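/- Let A ∈ ℝ^{n×d}, x ∈ ℝ^d, b ∈ ℝ^n, and define u(x) = exp(Ax), α(x) = ⟨u(x), 1_n⟩, c(x) = u(x) - α(x)·b, and B(x) = diag(u(x) ∘ u(x)) - (u(x) ∘ b)·u(x)^⊤ - u(x)·(u(x) ∘ b)^⊤ + ‖b‖_2² · u(x)u(x)^⊤ + diag(c(x) ∘ u(x)) - ⟨c(x), b⟩ · diag(u(x)). Let w ∈ ℝ^n, W = diag(w), let σ_min(A) > 0 be the minimum singular value of A, let l > 0, and let R₀ = max{‖u(x)‖_2, ‖b‖_2, ‖c(x)‖_2, 1}. If w_i² ≥ 200·R₀⁴ + l/σ_min(A)² for all i ∈ [n], then (1 - 1/10)·(B(x) + W²) ⪯ W² ⪯ (1 + 1/10)·(B(x) + W²) in the positive-semidefinite order. -/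

import Mathlib

/-- The Euclidean (ℓ2) norm of a vector in `ℝ^n`. -/
noncomputable def norm2 {n : ℕ} (v : Fin n → ℝ) : ℝ :=
  Real.sqrt (∑ i, v i ^ 2)

/-- `u(x) = exp(Ax)` applied entrywise. -/
noncomputable def uexp {n d : ℕ} (A : Matrix (Fin n) (Fin d) ℝ) (x : Fin d → ℝ) : Fin n → ℝ :=
  fun j => Real.exp (A.mulVec x j)

/-- `α(x) = ⟨u(x), 1_n⟩`. -/
noncomputable def alph {n d : ℕ} (A : Matrix (Fin n) (Fin d) ℝ) (x : Fin d → ℝ) : ℝ :=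
  ∑ j, uexp A x j

/-- `c(x) = u(x) - α(x)·b`. -/
noncomputable def cfun {n d : ℕ} (A : Matrix (Fin n) (Fin d) ℝ) (b : Fin n → ℝ)
    (x : Fin d → ℝ) : Fin n → ℝ :=
  uexp A x - alph A x • b

/-- `B(x) = diag(u∘u) - (u∘b)uᵀ - u(u∘b)ᵀ + ‖b‖₂²·uuᵀ + diag(c∘u) - ⟨c,b⟩·diag(u)`. -/
noncomputable def Bmat {n d : ℕ} (A : Matrix (Fin n) (Fin d) ℝ) (b : Fin n → ℝ)
    (x : Fin d → ℝ) : Matrix (Fin n) (Fin n) ℝ :=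
  Matrix.diagonal (fun k => uexp A x k * uexp A x k)
    - Matrix.vecMulVec (fun k => uexp A x k * b k) (uexp A x)
    - Matrix.vecMulVec (uexp A x) (fun k => uexp A x k * b k)
    + norm2 b ^ 2 • Matrix.vecMulVec (uexp A x) (uexp A x)
    + Matrix.diagonal (fun k => cfun A b x k * uexp A x k)
    - (∑ k, cfun A b x k * b k) • Matrix.diagonal (uexp A x)

open scoped Matrix

lemma norm2_sq {n : ℕ} (v : Fin n → ℝ) : norm2 v ^ 2 = ∑ i, v i ^ 2 :=
  Real.sq_sqrt (Finset.sum_nonneg fun _ _ => sq_nonneg _)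

lemma norm2_nonneg {n : ℕ} (v : Fin n → ℝ) : 0 ≤ norm2 v := Real.sqrt_nonneg _

lemma abs_apply_le_norm2 {n : ℕ} (v : Fin n → ℝ) (i : Fin n) : |v i| ≤ norm2 v := by
  refine abs_le_of_sq_le_sq ?_ (norm2_nonneg v)
  rw [norm2_sq]
  exact Finset.single_le_sum (f := fun i => v i ^ 2) (fun _ _ => sq_nonneg _) (Finset.mem_univ i)

lemma abs_sum_mul_le_norm2 {n : ℕ} (v w : Fin n → ℝ) :
    |∑ i, v i * w i| ≤ norm2 v * norm2 w := by
  refine abs_le_of_sq_le_sq ?_ (mul_nonneg (norm2_nonneg v) (norm2_nonneg w))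
  rw [mul_pow, norm2_sq, norm2_sq]
  exact Finset.sum_mul_sq_le_sq_mul_sq _ _ _

lemma abs_sum_mul_sq_le {n : ℕ} {f v : Fin n → ℝ} {K : ℝ} (hf : ∀ i, |f i| ≤ K) :
    |∑ i, f i * v i ^ 2| ≤ K * ∑ i, v i ^ 2 := by
  rw [Finset.mul_sum]
  refine (Finset.abs_sum_le_sum_abs _ _).trans (Finset.sum_le_sum fun i _ => ?_)
  rw [abs_mul, abs_of_nonneg (sq_nonneg (v i))]
  exact mul_le_mul_of_nonneg_right (hf i) (sq_nonneg _)

lemma norm2_mul_le {n : ℕ} (v w : Fin n → ℝ) :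
    norm2 (fun i => v i * w i) ≤ norm2 v * norm2 w := by
  refine (pow_le_pow_iff_left₀ (norm2_nonneg _)
    (mul_nonneg (norm2_nonneg v) (norm2_nonneg w)) two_ne_zero).mp ?_
  rw [mul_pow, norm2_sq, norm2_sq v, Finset.sum_mul]
  refine Finset.sum_le_sum fun i _ => ?_
  rw [mul_pow]
  refine mul_le_mul_of_nonneg_left ?_ (sq_nonneg _)
  exact sq_le_sq' (abs_le.mp (abs_apply_le_norm2 w i)).1 (abs_le.mp (abs_apply_le_norm2 w i)).2

lemma dotProduct_diagonal_mulVec_self {n : ℕ} (f v : Fin n → ℝ) :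
    v ⬝ᵥ (Matrix.diagonal f *ᵥ v) = ∑ i, f i * v i ^ 2 := by
  simp only [dotProduct, Matrix.mulVec_diagonal]
  exact Finset.sum_congr rfl fun i _ => by ring

lemma dotProduct_vecMulVec_mulVec_self {n : ℕ} (f g v : Fin n → ℝ) :
    v ⬝ᵥ (Matrix.vecMulVec f g *ᵥ v) = (∑ i, f i * v i) * ∑ i, g i * v i := by
  rw [Matrix.vecMulVec_mulVec]
  simp only [dotProduct, Pi.smul_apply, MulOpposite.smul_eq_mul_unop, MulOpposite.unop_op,
    Finset.sum_mul]
  exact Finset.sum_congr rfl fun i _ => by ring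

lemma Bmat_isHermitian {n d : ℕ} (A : Matrix (Fin n) (Fin d) ℝ) (b : Fin n → ℝ)
    (x : Fin d → ℝ) : (Bmat A b x).IsHermitian := by
  ext i j
  simp only [Bmat, Matrix.conjTranspose_apply, star_trivial, Matrix.add_apply, Matrix.sub_apply,
    Matrix.smul_apply, Matrix.vecMulVec_apply, Matrix.diagonal_apply, smul_eq_mul]
  by_cases h : i = j
  · subst h; ring
  · simp only [h, Ne.symm h, if_false]; ring

/-- The quadratic form of `B(x)` is bounded by `6R⁴‖v‖₂²`. -/
lemma abs_dotProduct_Bmat_mulVec_le {n d : ℕ} (A : Matrix (Fin n) (Fin d) ℝ) (b : Fin n → ℝ)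
    (x : Fin d → ℝ) {R : ℝ} (hR : 1 ≤ R) (hu : norm2 (uexp A x) ≤ R) (hb : norm2 b ≤ R)
    (hc : norm2 (cfun A b x) ≤ R) (v : Fin n → ℝ) :
    |v ⬝ᵥ (Bmat A b x *ᵥ v)| ≤ 6 * R ^ 4 * ∑ i, v i ^ 2 := by
  simp only [Bmat, Matrix.add_mulVec, Matrix.sub_mulVec, Matrix.smul_mulVec, dotProduct_add,
    dotProduct_sub, dotProduct_smul, dotProduct_diagonal_mulVec_self,
    dotProduct_vecMulVec_mulVec_self, smul_eq_mul]
  generalize uexp A x = u at *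
  generalize cfun A b x = c at *
  have hR0 : 0 ≤ R := zero_le_one.trans hR
  have hui i := (abs_apply_le_norm2 u i).trans hu
  have hci i := (abs_apply_le_norm2 c i).trans hc
  have hnv := norm2_nonneg v
  have huu := abs_sum_mul_sq_le (f := fun k => u k * u k) (v := v) (K := R * R) fun i => by
    rw [abs_mul]; exact mul_le_mul (hui i) (hui i) (abs_nonneg _) hR0
  have hcu := abs_sum_mul_sq_le (f := fun k => c k * u k) (v := v) (K := R * R) fun i => by
    rw [abs_mul]; exact mul_le_mul (hci i) (hui i) (abs_nonneg _) hR0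
  have hu1 := abs_sum_mul_sq_le (v := v) hui
  have hcb : |∑ k, c k * b k| ≤ R * R :=
    (abs_sum_mul_le_norm2 c b).trans (mul_le_mul hc hb (norm2_nonneg _) hR0)
  have hs : |∑ k, u k * v k| ≤ R * norm2 v :=
    (abs_sum_mul_le_norm2 u v).trans (mul_le_mul_of_nonneg_right hu hnv)
  have hp : |∑ k, u k * b k * v k| ≤ R * R * norm2 v :=
    (abs_sum_mul_le_norm2 (fun k => u k * b k) v).trans (mul_le_mul_of_nonneg_right
      ((norm2_mul_le u b).trans (mul_le_mul hu hb (norm2_nonneg _) hR0)) hnv)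
  have hbb : |norm2 b ^ 2| ≤ R * R := by
    rw [abs_of_nonneg (sq_nonneg _), sq]
    exact mul_le_mul hb hb (norm2_nonneg _) hR0
  rw [← norm2_sq] at *
  set V := norm2 v
  have hps := mul_le_mul hp hs (abs_nonneg _) (by positivity)
  have hss := mul_le_mul hs hs (abs_nonneg _) (by positivity)
  have hbss := mul_le_mul hbb hss (by positivity) (by positivity)
  have hcbu := mul_le_mul hcb hu1 (abs_nonneg _) (by positivity)
  simp only [← abs_mul] at hps hbss hcbu
  have h2 : R ^ 2 * V ^ 2 ≤ R ^ 4 * V ^ 2 := by gcongr; norm_num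
  have h3 : R ^ 3 * V ^ 2 ≤ R ^ 4 * V ^ 2 := by gcongr; norm_num
  rw [abs_le] at *
  constructor <;> nlinarith

/-- If `σmin > 0` is (a lower bound witnessing) the minimum singular value of `A`,
`l > 0`, `R₀ = max{‖u(x)‖₂, ‖b‖₂, ‖c(x)‖₂, 1}` and `w_i² ≥ 200·R₀⁴ + l/σmin²` for all `i`,
then `(1 - 1/10)·(B(x) + W²) ⪯ W² ⪯ (1 + 1/10)·(B(x) + W²)`. -/
theorem W2_approximates_hessian (n d : ℕ) (A : Matrix (Fin n) (Fin d) ℝ) (b w : Fin n → ℝ)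
    (x : Fin d → ℝ) (σmin l : ℝ) (hσpos : 0 < σmin)
    (hσ : ∀ v : Fin d → ℝ, σmin * norm2 v ≤ norm2 (A.mulVec v))
    (hl : 0 < l)
    (R₀ : ℝ) (hR₀ : R₀ = max (max (norm2 (uexp A x)) (norm2 b)) (max (norm2 (cfun A b x)) 1))
    (hw : ∀ i, 200 * R₀ ^ 4 + l / σmin ^ 2 ≤ w i ^ 2) :
    (Matrix.diagonal w ^ 2
        - (1 - 1 / 10 : ℝ) • (Bmat A b x + Matrix.diagonal w ^ 2)).PosSemidef ∧
    ((1 + 1 / 10 : ℝ) • (Bmat A b x + Matrix.diagonal w ^ 2)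
        - Matrix.diagonal w ^ 2).PosSemidef := by
  have hR : 1 ≤ R₀ := by rw [hR₀]; simp
  have hu : norm2 (uexp A x) ≤ R₀ := by rw [hR₀]; simp
  have hb : norm2 b ≤ R₀ := by rw [hR₀]; simp
  have hc : norm2 (cfun A b x) ≤ R₀ := by rw [hR₀]; simp
  have hB := abs_dotProduct_Bmat_mulVec_le A b x hR hu hb hc
  have hherm := Bmat_isHermitian A b x
  rw [Matrix.diagonal_pow]
  have hW : (Matrix.diagonal (w ^ 2)).IsHermitian := Matrix.isHermitian_diagonal _
  have hWv (v : Fin n → ℝ) :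
      200 * R₀ ^ 4 * ∑ i, v i ^ 2 ≤ v ⬝ᵥ (Matrix.diagonal (w ^ 2) *ᵥ v) := by
    rw [dotProduct_diagonal_mulVec_self, Finset.mul_sum]
    refine Finset.sum_le_sum fun i _ => mul_le_mul_of_nonneg_right ?_ (sq_nonneg _)
    exact (le_add_of_nonneg_right (by positivity)).trans (hw i)
  have hV (v : Fin n → ℝ) : 0 ≤ R₀ ^ 4 * ∑ i, v i ^ 2 := by positivity
  constructor
  · refine .of_dotProduct_mulVec_nonneg
      (hW.sub ((hherm.add hW).smul (IsSelfAdjoint.all _))) fun v => ?_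
    simp only [star_trivial, Matrix.sub_mulVec, Matrix.smul_mulVec, Matrix.add_mulVec,
      dotProduct_sub, dotProduct_smul, dotProduct_add, smul_eq_mul]
    linarith [hWv v, hV v, (abs_le.mp (hB v)).2]
  · refine .of_dotProduct_mulVec_nonneg
      (((hherm.add hW).smul (IsSelfAdjoint.all _)).sub hW) fun v => ?_
    simp only [star_trivial, Matrix.sub_mulVec, Matrix.smul_mulVec, Matrix.add_mulVec,
      dotProduct_sub, dotProduct_smul, dotProduct_add, smul_eq_mul]
    linarith [hWv v, hV v, (abs_le.mp (hB v)).1]
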